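/- Let M be a squarefree positive integer. Then the number of negative fundamental discriminants D with |D| < x and gcd(D, M) = 1 is asymptotically (1/2)·(x/ζ(2))·M/∏_{q prime, q|M}(q+1) as x → ∞. -/

import Mathlib

open Filter Real Finset

/-- `D` is the discriminant of an imaginary quadratic field: either `D ≡ 1 (mod 4)` and `D` is
squarefree, or `D = 4d` with `d` squarefree and `d ≡ 2, 3 (mod 4)`; and `D < 0`. -/
def IsNegFundDisc (D : ℤ) : Prop :=
  D < 0 ∧ ((D % 4 = 1 ∧ Squarefree D) ∨
    ∃ d : ℤ, D = 4 * d ∧ Squarefree d ∧ (d % 4 = 2 ∨ d % 4 = 3))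

theorem tendsto_natCount_div_of_periodic (p : ℕ → Prop) [DecidablePred p] {W : ℕ} (hW : W ≠ 0)
    (hper : Function.Periodic p W) :
    Tendsto (fun n : ℕ => (Nat.count p n : ℝ) / n) atTop (nhds ((Nat.count p W : ℝ) / W)) := by
  have key : ∀ n, Nat.count p n = n / W * Nat.count p W + Nat.count p (n % W) := by
    have hmul : ∀ k r, Nat.count p (W * k + r) = k * Nat.count p W + Nat.count p r := by
      intro k r
      induction k with
      | zero => simp
      | succ k ih =>
        have h : W * (k + 1) + r = W + (W * k + r) := by ring
        rw [h, Nat.count_add]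
        have h2 : (fun j => p (W + j)) = p := by
          funext j
          rw [add_comm]
          exact hper j
        simp only [h2]
        rw [ih]
        ring
    intro n
    conv_lhs => rw [← Nat.div_add_mod n W]
    exact hmul _ _
  have hW' : (0 : ℝ) < W := by positivity
  rw [tendsto_iff_norm_sub_tendsto_zero]
  refine squeeze_zero' (.of_forall fun _ => norm_nonneg _) ?_
    (tendsto_const_nhds.div_atTop tendsto_natCast_atTop_atTop : Tendsto (fun n : ℕ =>
      (W : ℝ) / n) atTop (nhds 0))
  filter_upwards [eventually_gt_atTop 0] with n hn
  have hn' : (0 : ℝ) < n := by positivity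
  have h1 : (n : ℝ) = W * (n / W : ℕ) + (n % W : ℕ) := by
    exact_mod_cast (Nat.div_add_mod n W).symm
  have h2 : (Nat.count p n : ℝ) = (n / W : ℕ) * Nat.count p W + Nat.count p (n % W) := by
    exact_mod_cast key n
  have hr : ((n % W : ℕ) : ℝ) ≤ W := by exact_mod_cast (Nat.mod_lt n (by omega)).le
  have hc : (Nat.count p (n % W) : ℝ) ≤ (n % W : ℕ) := by exact_mod_cast Nat.count_le _
  have hcW : (Nat.count p W : ℝ) ≤ W := by exact_mod_cast Nat.count_le _
  have h3 : (Nat.count p n : ℝ) / n - Nat.count p W / W =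
      (Nat.count p (n % W) - (n % W : ℕ) * (Nat.count p W / W)) / n := by
    rw [h2]
    field_simp
    rw [h1]
    ring_nf
  rw [h3, norm_div, Real.norm_of_nonneg hn'.le]
  gcongr
  have h4 : (Nat.count p W : ℝ) / W ≤ 1 := by rw [div_le_one hW']; exact hcW
  have h5 : (0 : ℝ) ≤ Nat.count p W / W := by positivity
  rw [Real.norm_eq_abs, abs_le]
  constructor <;> nlinarith [(Nat.cast_nonneg (n % W) : (0 : ℝ) ≤ (n % W : ℕ)),
    (Nat.cast_nonneg (Nat.count p (n % W)) : (0 : ℝ) ≤ (Nat.count p (n % W) : ℕ))]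

theorem tendsto_natCount_ceil_div_of_periodic (p : ℕ → Prop) [DecidablePred p] {W : ℕ}
    (hW : W ≠ 0) (hper : Function.Periodic p W) :
    Tendsto (fun x : ℝ => (Nat.count p ⌈x⌉₊ : ℝ) / x) atTop (nhds ((Nat.count p W : ℝ) / W)) := by
  have h := ((tendsto_natCount_div_of_periodic p hW hper).comp
    (tendsto_nat_ceil_atTop (α := ℝ))).mul (tendsto_nat_ceil_div_atTop (R := ℝ))
  rw [mul_one] at h
  refine h.congr' ?_
  filter_upwards [eventually_gt_atTop 0] with x hx
  have : (0 : ℝ) < ⌈x⌉₊ := by exact_mod_cast Nat.ceil_pos.mpr hx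
  simp only [Function.comp]
  field_simp

theorem sum_moebius_sq_dvd {n X : ℕ} (hn : n ≠ 0) (hX : n < X) :
    (∑ d ∈ range X, if d ^ 2 ∣ n then ArithmeticFunction.moebius d else 0) =
      if Squarefree n then 1 else 0 := by
  obtain ⟨a, b, hab, ha⟩ := Nat.sq_mul_squarefree n
  have hb : b ≠ 0 := by rintro rfl; simp at hab; exact hn hab.symm
  have hdvd : ∀ d, d ^ 2 ∣ n ↔ d ∣ b := by
    intro d
    constructor
    · intro h
      rw [← hab] at h
      obtain ⟨g, d', b', hg, hco, rfl, rfl⟩ := Nat.exists_coprime' (m := d) (n := b)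
        (Nat.gcd_pos_of_pos_right _ (Nat.pos_of_ne_zero hb))
      rw [mul_pow, mul_pow, mul_right_comm] at h
      have h2 := Nat.dvd_of_mul_dvd_mul_right (by positivity) h
      have h3 : d' ^ 2 ∣ a := (Nat.Coprime.pow 2 2 hco).dvd_of_dvd_mul_left h2
      have h4 : d' = 1 := by
        have := ha d' (by rwa [← sq])
        simpa using this
      subst h4
      simp
    · intro h
      rw [← hab]
      exact (pow_dvd_pow_of_dvd h 2).mul_right a
  have h1 : (∑ d ∈ range X, if d ^ 2 ∣ n then ArithmeticFunction.moebius d else 0) =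
      ∑ d ∈ b.divisors, ArithmeticFunction.moebius d := by
    rw [← Finset.sum_filter]
    congr 1
    ext d
    simp only [mem_filter, mem_range, Nat.mem_divisors, hdvd]
    refine ⟨fun h => ⟨h.2, hb⟩, fun h => ⟨lt_of_le_of_lt ?_ hX, h.1⟩⟩
    exact Nat.le_of_dvd (Nat.pos_of_ne_zero hn)
      ((Dvd.intro_left _ (sq d).symm).trans ((hdvd d).2 h.1))
  rw [h1, ← ArithmeticFunction.coe_mul_zeta_apply, ArithmeticFunction.moebius_mul_coe_zeta,
    ArithmeticFunction.one_apply]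
  congr 1
  rw [eq_iff_iff]
  constructor
  · rintro rfl
    rw [← hab]
    simpa using ha
  · intro h
    have := h b (by rw [← sq, hdvd])
    simpa using this

theorem natCount_squarefree_ceil_eq_tsum (p : ℕ → Prop) [DecidablePred p] {W : ℕ} (h0 : ¬ p 0)
    (hp : ∀ d m, p (d ^ 2 * m) ↔ d.Coprime W ∧ p m) (x : ℝ) :
    (Nat.count (fun n => Squarefree n ∧ p n) ⌈x⌉₊ : ℝ) =
      ∑' d : ℕ, if d.Coprime W then
        (ArithmeticFunction.moebius d : ℝ) * Nat.count p ⌈x / (d : ℝ) ^ 2⌉₊ else 0 := by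
  have hinner : ∀ d : ℕ, d ≠ 0 → #{n ∈ range ⌈x⌉₊ | p n ∧ d ^ 2 ∣ n} =
      if d.Coprime W then Nat.count p ⌈x / (d : ℝ) ^ 2⌉₊ else 0 := by
    intro d hd
    have hd' : (0 : ℝ) < (d : ℝ) ^ 2 := by positivity
    split_ifs with hdW
    · rw [Nat.count_eq_card_filter_range]
      symm
      apply Finset.card_bij (fun m _ => d ^ 2 * m)
      · intro m hm
        simp only [mem_filter, mem_range, Nat.lt_ceil] at hm ⊢
        refine ⟨?_, (hp d m).2 ⟨hdW, hm.2⟩, dvd_mul_right _ _⟩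
        have := (lt_div_iff₀ hd').1 hm.1
        push_cast
        linarith
      · intro m _ m' _ h
        exact Nat.eq_of_mul_eq_mul_left (by positivity) h
      · intro n hn
        simp only [mem_filter, mem_range, Nat.lt_ceil] at hn
        obtain ⟨hnx, hpn, m, rfl⟩ := hn
        refine ⟨m, ?_, rfl⟩
        simp only [mem_filter, mem_range, Nat.lt_ceil]
        refine ⟨?_, ((hp d m).1 hpn).2⟩
        rw [lt_div_iff₀ hd']
        push_cast at hnx
        linarith
    · rw [Finset.card_eq_zero, Finset.filter_eq_empty_iff]
      rintro n _ ⟨hpn, m, rfl⟩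
      exact hdW ((hp d m).1 hpn).1
  rw [tsum_eq_sum (s := range ⌈x⌉₊)]
  · have h1 : (Nat.count (fun n => Squarefree n ∧ p n) ⌈x⌉₊ : ℤ) =
        ∑ n ∈ range ⌈x⌉₊, ∑ d ∈ range ⌈x⌉₊,
          if p n ∧ d ^ 2 ∣ n then ArithmeticFunction.moebius d else 0 := by
      rw [Nat.count_eq_card_filter_range, Finset.card_filter]
      push_cast
      refine Finset.sum_congr rfl fun n hn => ?_
      by_cases hpn : p n
      · have hn0 : n ≠ 0 := by rintro rfl; exact h0 hpn
        simp only [hpn, and_true, true_and]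
        rw [sum_moebius_sq_dvd hn0 (mem_range.1 hn)]
      · simp [hpn]
    rw [Finset.sum_comm] at h1
    have h2 : (Nat.count (fun n => Squarefree n ∧ p n) ⌈x⌉₊ : ℝ) =
        ((Nat.count (fun n => Squarefree n ∧ p n) ⌈x⌉₊ : ℤ) : ℝ) := by simp
    rw [h2, h1, Int.cast_sum]
    refine Finset.sum_congr rfl fun d _ => ?_
    rw [← Finset.sum_filter, Finset.sum_const]
    rcases eq_or_ne d 0 with rfl | hd
    · simp
    rw [hinner d hd]
    split_ifs <;> simp [mul_comm]
  · intro d hd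
    rw [mem_range, not_lt, Nat.ceil_le] at hd
    rcases eq_or_ne d 0 with rfl | hd0
    · simp
    have hd1 : (1 : ℝ) ≤ d := by exact_mod_cast Nat.one_le_iff_ne_zero.2 hd0
    have h3 : ⌈x / (d : ℝ) ^ 2⌉₊ ≤ 1 := by
      rw [Nat.ceil_le, div_le_iff₀ (by positivity)]
      push_cast
      nlinarith
    have h4 : Nat.count p ⌈x / (d : ℝ) ^ 2⌉₊ = 0 := by
      have := Nat.count_monotone p h3
      simpa [Nat.count_succ, h0] using this
    simp [h4]

theorem tendsto_natCount_squarefree_ceil_div (p : ℕ → Prop) [DecidablePred p] {W : ℕ}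
    (hW : W ≠ 0) (hper : Function.Periodic p W) (h0 : ¬ p 0)
    (hp : ∀ d m, p (d ^ 2 * m) ↔ d.Coprime W ∧ p m) :
    Tendsto (fun x : ℝ => (Nat.count (fun n => Squarefree n ∧ p n) ⌈x⌉₊ : ℝ) / x) atTop
      (nhds ((Nat.count p W : ℝ) / W *
        ∑' d : ℕ, if d.Coprime W then (ArithmeticFunction.moebius d : ℝ) / (d : ℝ) ^ 2 else 0)) := by
  simp_rw [natCount_squarefree_ceil_eq_tsum p h0 hp, ← tsum_div_const, ← tsum_mul_left]
  refine tendsto_tsum_of_dominated_convergence (bound := fun d : ℕ => 1 / (d : ℝ) ^ 2)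
    (Real.summable_one_div_nat_pow.2 one_lt_two) ?_ ?_
  · intro d
    rcases eq_or_ne d 0 with rfl | hd
    · simp
    have hd' : (0 : ℝ) < (d : ℝ) ^ 2 := by positivity
    split_ifs
    · have h1 := ((tendsto_natCount_ceil_div_of_periodic p hW hper).comp
        (tendsto_id.atTop_div_const hd')).const_mul
        ((ArithmeticFunction.moebius d : ℝ) / (d : ℝ) ^ 2)
      rw [mul_comm]
      refine h1.congr fun x => ?_
      simp only [Function.comp, id]
      field_simp
    · simp
  · filter_upwards [eventually_gt_atTop 0] with x hx d
    rcases eq_or_ne d 0 with rfl | hd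
    · simp
    have hd' : (0 : ℝ) < (d : ℝ) ^ 2 := by positivity
    split_ifs
    · have hc : (Nat.count p ⌈x / (d : ℝ) ^ 2⌉₊ : ℝ) ≤ x / (d : ℝ) ^ 2 := by
        have hpos : 0 < ⌈x / (d : ℝ) ^ 2⌉₊ := Nat.ceil_pos.2 (by positivity)
        obtain ⟨k, hk⟩ := Nat.exists_eq_succ_of_ne_zero hpos.ne'
        have h1 : Nat.count p ⌈x / (d : ℝ) ^ 2⌉₊ ≤ k := by
          rw [hk, Nat.succ_eq_add_one, Nat.count_succ']
          simpa [h0] using Nat.count_le _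
        have h2 : (k : ℝ) < x / (d : ℝ) ^ 2 := Nat.lt_ceil.1 (by omega)
        exact (by exact_mod_cast h1 : (Nat.count p ⌈x / (d : ℝ) ^ 2⌉₊ : ℝ) ≤ k).trans h2.le
      have hm : |(ArithmeticFunction.moebius d : ℝ)| ≤ 1 := by
        exact_mod_cast ArithmeticFunction.abs_moebius_le_one
      rw [Real.norm_eq_abs, abs_div, abs_mul, abs_of_pos hx, Nat.abs_cast, div_le_iff₀ hx]
      calc _ ≤ 1 * (x / (d : ℝ) ^ 2) := by gcongr
        _ = _ := by ring
    · simp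

theorem tsum_moebius_div_sq_of_coprime {W : ℕ} (hW : W ≠ 0) :
    (∑' d : ℕ, if d.Coprime W then (ArithmeticFunction.moebius d : ℝ) / (d : ℝ) ^ 2 else 0) =
      1 / ((∏ q ∈ W.primeFactors, (1 - 1 / (q : ℝ) ^ 2)) * (π ^ 2 / 6)) := by
  have : NeZero W := ⟨hW⟩
  have hs : 1 < (2 : ℂ).re := by norm_num
  have h := DirichletCharacter.LSeries.mul_mu_eq_one (1 : DirichletCharacter ℂ W) hs
  rw [← DirichletCharacter.LFunction_eq_LSeries _ hs] at h
  have h2 := DirichletCharacter.LFunctionTrivChar_eq_mul_riemannZeta (N := W) (s := 2) (by norm_num)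
  rw [DirichletCharacter.LFunctionTrivChar] at h2
  rw [h2, riemannZeta_two] at h
  apply Complex.ofReal_injective
  have h3 := eq_one_div_of_mul_eq_one_right h
  rw [LSeries] at h3
  rw [Complex.ofReal_tsum]
  convert h3 using 1
  · refine tsum_congr fun d => ?_
    rcases eq_or_ne d 0 with rfl | hd
    · simp
    rw [LSeries.term_of_ne_zero hd]
    have h2 : (d : ℂ) ^ (2 : ℂ) = (d : ℂ) ^ 2 := by
      exact_mod_cast Complex.cpow_natCast (d : ℂ) 2
    rw [h2, Pi.mul_apply]
    split_ifs with hc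
    · rw [MulChar.one_apply ((ZMod.isUnit_iff_coprime d W).2 hc)]
      push_cast
      ring
    · rw [MulChar.map_nonunit _ (fun hu => hc ((ZMod.isUnit_iff_coprime d W).1 hu))]
      simp
  · push_cast
    congr 2
    refine Finset.prod_congr rfl fun q _ => ?_
    rw [Complex.cpow_neg, one_div]
    congr 2
    exact_mod_cast (Complex.cpow_natCast (q : ℂ) 2).symm

theorem natCount_mod_four_coprime {N a : ℕ} (hN : Odd N) (ha : a = 1 ∨ a = 3) :
    Nat.count (fun n => n % 4 = a ∧ n.Coprime N) (4 * N) = N.totient := by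
  have hrefl : ∀ b c : ℕ, (b = 1 ∧ c = 3 ∨ b = 3 ∧ c = 1) →
      Nat.count (fun n => n % 4 = b ∧ n.Coprime N) (4 * N) ≤
      Nat.count (fun n => n % 4 = c ∧ n.Coprime N) (4 * N) := by
    intro b c hbc
    rw [Nat.count_eq_card_filter_range, Nat.count_eq_card_filter_range]
    apply Finset.card_le_card_of_injOn (fun n => 4 * N - n)
    · intro n hn
      simp only [coe_filter, mem_range, Set.mem_ofPred_eq] at hn ⊢
      obtain ⟨h1, h2, h3⟩ := hn
      refine ⟨by omega, by omega, ?_⟩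
      rw [Nat.coprime_iff_gcd_eq_one] at h3
      refine Nat.eq_one_of_dvd_one (h3 ▸ Nat.dvd_gcd ?_ (Nat.gcd_dvd_right _ _))
      have h4 := Nat.dvd_sub ((Nat.gcd_dvd_right (4 * N - n) N).mul_left 4)
        (Nat.gcd_dvd_left (4 * N - n) N)
      rwa [Nat.sub_sub_self h1.le] at h4
    · intro n hn m hm h
      simp only [coe_filter, mem_range, Set.mem_ofPred_eq] at hn hm h
      omega
  have heq : Nat.count (fun n => n % 4 = 1 ∧ n.Coprime N) (4 * N) =
      Nat.count (fun n => n % 4 = 3 ∧ n.Coprime N) (4 * N) :=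
    le_antisymm (hrefl 1 3 (by simp)) (hrefl 3 1 (by simp))
  have hsum : Nat.count (fun n => n % 4 = 1 ∧ n.Coprime N) (4 * N) +
      Nat.count (fun n => n % 4 = 3 ∧ n.Coprime N) (4 * N) = 2 * N.totient := by
    have h42 : Nat.totient 4 = 2 := by decide
    have h4N : Nat.Coprime 4 N := hN.coprime_two_left.pow_left 2
    rw [← h42, ← Nat.totient_mul h4N, Nat.totient_eq_card_coprime, Nat.count_eq_card_filter_range,
      Nat.count_eq_card_filter_range, ← Finset.card_union_of_disjoint]
    · congr 1
      ext n
      simp only [mem_union, mem_filter, mem_range]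
      have h1 : Nat.Coprime (2 ^ 2 * N) n ↔ (n % 4 = 1 ∨ n % 4 = 3) ∧ n.Coprime N := by
        rw [Nat.coprime_mul_iff_left, Nat.coprime_pow_left_iff two_pos, Nat.coprime_two_left,
          Nat.coprime_comm (m := N), Nat.odd_iff]
        have : n % 2 = 1 ↔ (n % 4 = 1 ∨ n % 4 = 3) := by omega
        rw [this]
      norm_num at h1
      rw [h1]
      tauto
    · rw [Finset.disjoint_filter]
      intro n _ h1 h2
      omega
  rcases ha with rfl | rfl <;> omega

theorem totient_div_mul_prod_of_squarefree {N : ℕ} (hN : Squarefree N) :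
    (N.totient : ℝ) / N * (1 / ∏ q ∈ N.primeFactors, (1 - 1 / (q : ℝ) ^ 2)) =
      N / ∏ q ∈ N.primeFactors, ((q : ℝ) + 1) := by
  have hN0 : (N : ℝ) ≠ 0 := by exact_mod_cast hN.ne_zero
  have h1 : (N.totient : ℝ) = N * ∏ q ∈ N.primeFactors, (1 - (q : ℝ)⁻¹) := by
    simpa using congrArg (Rat.cast : ℚ → ℝ) (Nat.totient_eq_mul_prod_factors N)
  have h2 : (N : ℝ) / ∏ q ∈ N.primeFactors, ((q : ℝ) + 1) =
      ∏ q ∈ N.primeFactors, ((q : ℝ) / (q + 1)) := by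
    rw [Finset.prod_div_distrib]
    congr 1
    simpa using congrArg (Nat.cast : ℕ → ℝ) (Nat.prod_primeFactors_of_squarefree hN).symm
  rw [h2, h1, mul_div_cancel_left₀ _ hN0, one_div, ← Finset.prod_inv_distrib,
    ← Finset.prod_mul_distrib]
  refine Finset.prod_congr rfl fun q hq => ?_
  have hq1 : (1 : ℝ) < q := by exact_mod_cast (Nat.prime_of_mem_primeFactors hq).one_lt
  have h3 : (q : ℝ) - 1 ≠ 0 := by linarith
  have h4 : (q : ℝ) + 1 ≠ 0 := by linarith
  have h5 : (q : ℝ) ≠ 0 := by linarith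
  have h6 : 1 - 1 / (q : ℝ) ^ 2 = (q - 1) * (q + 1) / q ^ 2 := by
    field_simp
    ring
  rw [h6]
  field_simp

theorem tendsto_natCount_squarefree_mod_four_coprime {N a : ℕ} (hN : Odd N) (hsf : Squarefree N)
    (ha : a = 1 ∨ a = 3) :
    Tendsto (fun x : ℝ =>
      (Nat.count (fun n => Squarefree n ∧ n % 4 = a ∧ n.Coprime N) ⌈x⌉₊ : ℝ) / x) atTop
      (nhds (1 / 3 / (π ^ 2 / 6) * (N / ∏ q ∈ N.primeFactors, ((q : ℝ) + 1)))) := by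
  have hN0 : N ≠ 0 := hsf.ne_zero
  have hcop : Nat.Coprime 4 N := hN.coprime_two_left.pow_left 2
  have h := tendsto_natCount_squarefree_ceil_div (fun n => n % 4 = a ∧ n.Coprime N)
    (W := 4 * N) (by omega) ?_ ?_ ?_
  · rw [natCount_mod_four_coprime hN ha, tsum_moebius_div_sq_of_coprime (by omega),
      hcop.primeFactors_mul, Finset.prod_union hcop.disjoint_primeFactors] at h
    have h4 : Nat.primeFactors 4 = {2} := by
      rw [show 4 = 2 ^ 2 by norm_num]
      exact Nat.primeFactors_prime_pow two_ne_zero Nat.prime_two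
    rw [h4, Finset.prod_singleton] at h
    convert h using 2
    rw [← totient_div_mul_prod_of_squarefree hsf]
    push_cast
    generalize ∏ q ∈ N.primeFactors, (1 - 1 / (q : ℝ) ^ 2) = P
    rcases eq_or_ne P 0 with rfl | hP
    · simp
    field_simp
    norm_num
  · intro n
    have h1 : (n + 4 * N) % 4 = n % 4 := by omega
    have h2 : Nat.Coprime (n + 4 * N) N ↔ Nat.Coprime n N := by simp
    simp only [h1, h2]
  · simp only [Nat.zero_mod]
    omega
  · intro d m
    rw [Nat.coprime_mul_iff_left, Nat.coprime_mul_iff_right, Nat.coprime_pow_left_iff two_pos]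
    have h4 : Nat.Coprime d 4 ↔ d % 2 = 1 := by
      rw [show 4 = 2 ^ 2 by norm_num, Nat.coprime_pow_right_iff two_pos, Nat.coprime_two_right,
        Nat.odd_iff]
    have h5 : d ^ 2 * m % 4 = a ↔ d % 2 = 1 ∧ m % 4 = a := by
      rw [Nat.mul_mod, Nat.pow_mod]
      have h6 : d % 4 < 4 := Nat.mod_lt _ (by norm_num)
      have h7 : m % 4 < 4 := Nat.mod_lt _ (by norm_num)
      have h8 : d % 2 = d % 4 % 2 := by omega
      rw [h8]
      generalize d % 4 = r at *
      generalize m % 4 = s at *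
      interval_cases r <;> interval_cases s <;> omega
    rw [h4, h5]
    tauto

theorem isNegFundDisc_neg_natCast_iff (n : ℕ) :
    IsNegFundDisc (-(n : ℤ)) ↔ (Squarefree n ∧ n % 4 = 3) ∨
      (∃ m, n = 4 * m ∧ Squarefree m ∧ m % 4 = 1) ∨
      ∃ m, n = 8 * m ∧ Squarefree m ∧ (m % 4 = 1 ∨ m % 4 = 3) := by
  have hneg : ∀ k : ℕ, Squarefree (-(k : ℤ)) ↔ Squarefree k := fun k => by
    rw [← Int.squarefree_natAbs, Int.natAbs_neg, Int.natAbs_natCast]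
  have htwo : ∀ k : ℕ, k % 2 = 1 → (Squarefree (2 * k) ↔ Squarefree k) := fun k hk => by
    rw [Nat.squarefree_mul (Nat.coprime_two_left.2 (Nat.odd_iff.2 hk))]
    simp [Nat.prime_two.squarefree]
  constructor
  · rintro ⟨hn, ⟨h1, h2⟩ | ⟨d, hd, h2, h3⟩⟩
    · exact Or.inl ⟨(hneg n).1 h2, by omega⟩
    · obtain ⟨e, rfl⟩ : ∃ e : ℕ, d = -(e : ℤ) := ⟨d.natAbs, by omega⟩
      rw [hneg] at h2
      rcases h3 with h3 | h3
      · obtain ⟨m, rfl⟩ : ∃ m, e = 2 * m := ⟨e / 2, by omega⟩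
        exact Or.inr (Or.inr ⟨m, by omega, (htwo m (by omega)).1 h2, by omega⟩)
      · exact Or.inr (Or.inl ⟨e, by omega, h2, by omega⟩)
  · rintro (⟨h1, h2⟩ | ⟨m, rfl, h1, h2⟩ | ⟨m, rfl, h1, h2⟩)
    · exact ⟨by omega, Or.inl ⟨by omega, (hneg n).2 h1⟩⟩
    · exact ⟨by omega, Or.inr ⟨-(m : ℤ), by push_cast; ring, (hneg m).2 h1, by omega⟩⟩
    · exact ⟨by omega, Or.inr ⟨-((2 * m : ℕ) : ℤ), by push_cast; ring,
        (hneg _).2 ((htwo m (by omega)).2 h1), by omega⟩⟩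

theorem natCard_negFundDisc_coprime_eq {M : ℕ} {x : ℝ} {s : Finset ℕ}
    (hs : ∀ n : ℕ, n ∈ s ↔ IsNegFundDisc (-(n : ℤ)) ∧ (n : ℝ) < x ∧ n.Coprime M) :
    Nat.card {D : ℤ | IsNegFundDisc D ∧ |(D : ℝ)| < x ∧ Int.gcd D (M : ℤ) = 1} = #s := by
  have hset : {D : ℤ | IsNegFundDisc D ∧ |(D : ℝ)| < x ∧ Int.gcd D (M : ℤ) = 1} =
      ↑(s.image fun n : ℕ => -(n : ℤ)) := by
    ext D
    simp only [Set.mem_ofPred_eq, coe_image, Set.mem_image, mem_coe, hs]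
    constructor
    · rintro ⟨h1, h2, h3⟩
      obtain ⟨n, rfl⟩ : ∃ n : ℕ, D = -(n : ℤ) := ⟨D.natAbs, by have := h1.1; omega⟩
      exact ⟨n, ⟨h1, by simpa using h2, by simpa [Nat.Coprime] using h3⟩, rfl⟩
    · rintro ⟨n, ⟨h1, h2, h3⟩, rfl⟩
      exact ⟨h1, by simpa using h2, by simpa [Nat.Coprime] using h3⟩
  rw [hset, Nat.card_coe_set_eq, Set.ncard_coe_finset, Finset.card_image_of_injective]
  intro a b h
  simpa using h

theorem natCard_negFundDisc_coprime_two_mul {N : ℕ} (x : ℝ) :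
    Nat.card {D : ℤ | IsNegFundDisc D ∧ |(D : ℝ)| < x ∧ Int.gcd D ((2 * N : ℕ) : ℤ) = 1} =
      Nat.count (fun n => Squarefree n ∧ n % 4 = 3 ∧ n.Coprime N) ⌈x⌉₊ := by
  rw [Nat.count_eq_card_filter_range]
  refine natCard_negFundDisc_coprime_eq fun n => ?_
  rw [mem_filter, mem_range, Nat.lt_ceil, isNegFundDisc_neg_natCast_iff,
    Nat.coprime_mul_iff_right, Nat.coprime_two_right, Nat.odd_iff]
  constructor
  · rintro ⟨h1, h2, h3, h4⟩
    exact ⟨Or.inl ⟨h2, h3⟩, h1, by omega, h4⟩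
  · rintro ⟨⟨h1, h2⟩ | ⟨m, rfl, h1, h2⟩ | ⟨m, rfl, h1, h2⟩, h3, h4, h5⟩
    · exact ⟨h3, h1, h2, h5⟩
    · omega
    · omega

theorem natCard_negFundDisc_coprime_of_odd {M : ℕ} (hM : Odd M) (x : ℝ) :
    Nat.card {D : ℤ | IsNegFundDisc D ∧ |(D : ℝ)| < x ∧ Int.gcd D (M : ℤ) = 1} =
      Nat.count (fun n => Squarefree n ∧ n % 4 = 3 ∧ n.Coprime M) ⌈x⌉₊ +
      Nat.count (fun n => Squarefree n ∧ n % 4 = 1 ∧ n.Coprime M) ⌈x / 4⌉₊ +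
      (Nat.count (fun n => Squarefree n ∧ n % 4 = 1 ∧ n.Coprime M) ⌈x / 8⌉₊ +
      Nat.count (fun n => Squarefree n ∧ n % 4 = 3 ∧ n.Coprime M) ⌈x / 8⌉₊) := by
  have hinj : ∀ k : ℕ, 0 < k → Function.Injective (fun n : ℕ => k * n) :=
    fun k hk a b h => Nat.eq_of_mul_eq_mul_left hk h
  simp only [Nat.count_eq_card_filter_range]
  rw [← Finset.card_image_of_injective (filter _ (range ⌈x / 4⌉₊)) (hinj 4 (by norm_num)),
    ← Finset.card_union_of_disjoint (s := filter _ (range ⌈x / 8⌉₊)),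
    ← Finset.card_image_of_injective (filter _ (range ⌈x / 8⌉₊) ∪ _) (hinj 8 (by norm_num)),
    ← Finset.card_union_of_disjoint, ← Finset.card_union_of_disjoint]
  · refine natCard_negFundDisc_coprime_eq fun n => ?_
    have h4 : Nat.Coprime 4 M := hM.coprime_two_left.pow_left 2
    have h8 : Nat.Coprime 8 M := hM.coprime_two_left.pow_left 3
    have hc4 : ∀ m, Nat.Coprime (4 * m) M ↔ Nat.Coprime m M := fun m => by
      rw [Nat.coprime_mul_iff_left, and_iff_right h4]
    have hc8 : ∀ m, Nat.Coprime (8 * m) M ↔ Nat.Coprime m M := fun m => by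
      rw [Nat.coprime_mul_iff_left, and_iff_right h8]
    simp only [mem_union, mem_image, mem_filter, mem_range, Nat.lt_ceil,
      isNegFundDisc_neg_natCast_iff]
    constructor
    · rintro ((⟨h1, h2, h3, h4⟩ | ⟨m, ⟨h1, h2, h3, h4⟩, rfl⟩) |
        ⟨m, ⟨h1, h2, h3, h4⟩ | ⟨h1, h2, h3, h4⟩, rfl⟩)
      · exact ⟨Or.inl ⟨h2, h3⟩, h1, h4⟩
      · exact ⟨Or.inr (Or.inl ⟨m, rfl, h2, h3⟩), by push_cast; linarith, (hc4 m).2 h4⟩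
      · exact ⟨Or.inr (Or.inr ⟨m, rfl, h2, Or.inl h3⟩), by push_cast; linarith, (hc8 m).2 h4⟩
      · exact ⟨Or.inr (Or.inr ⟨m, rfl, h2, Or.inr h3⟩), by push_cast; linarith, (hc8 m).2 h4⟩
    · rintro ⟨⟨h1, h2⟩ | ⟨m, rfl, h1, h2⟩ | ⟨m, rfl, h1, h2⟩, h3, h5⟩
      · exact Or.inl (Or.inl ⟨h3, h1, h2, h5⟩)
      · push_cast at h3
        exact Or.inl (Or.inr ⟨m, ⟨by linarith, h1, h2, (hc4 m).1 h5⟩, rfl⟩)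
      · push_cast at h3
        have h6 : (m : ℝ) < x / 8 := by linarith
        refine Or.inr ⟨m, ?_, rfl⟩
        rcases h2 with h2 | h2
        · exact Or.inl ⟨h6, h1, h2, (hc8 m).1 h5⟩
        · exact Or.inr ⟨h6, h1, h2, (hc8 m).1 h5⟩
  · rw [Finset.disjoint_left]
    simp only [mem_union, mem_image, mem_filter, mem_range, Nat.lt_ceil]
    rintro n (h | ⟨m, ⟨_, _, h, _⟩, rfl⟩) ⟨k, _, hk⟩ <;> omega
  · rw [Finset.disjoint_left]
    simp only [mem_image, mem_filter, mem_range, Nat.lt_ceil]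
    rintro n h ⟨k, _, hk⟩
    omega
  · rw [Finset.disjoint_filter]
    intro n _ h1 h2
    omega

/-- For a squarefree positive integer `M`, the number of negative fundamental discriminants `D`
with `|D| < x` and `gcd(D, M) = 1` is asymptotically
`(1/2) · (x / ζ(2)) · M / ∏_{q prime, q ∣ M} (q + 1)` as `x → ∞`, where `ζ(2) = π²/6`. -/
theorem count_neg_fund_disc_coprime (M : ℕ) (hMpos : 0 < M) (hMsf : Squarefree M) :
    Filter.Tendsto
      (fun x : ℝ =>
        (Nat.card {D : ℤ | IsNegFundDisc D ∧ |(D : ℝ)| < x ∧ Int.gcd D (M : ℤ) = 1} : ℝ) /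
          ((1 / 2) * (x / (Real.pi ^ 2 / 6)) *
            ((M : ℝ) / ∏ q ∈ M.primeFactors, ((q : ℝ) + 1))))
      Filter.atTop (nhds 1) := by
  have hM0 : (M : ℝ) ≠ 0 := by exact_mod_cast hMpos.ne'
  set c : ℝ := 1 / 2 / (π ^ 2 / 6) * ((M : ℝ) / ∏ q ∈ M.primeFactors, ((q : ℝ) + 1)) with hc
  have hc0 : c ≠ 0 := by
    rw [hc]
    positivity
  suffices h : Tendsto (fun x : ℝ => (Nat.card {D : ℤ | IsNegFundDisc D ∧ |(D : ℝ)| < x ∧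
      Int.gcd D (M : ℤ) = 1} : ℝ) / x) atTop (nhds c) by
    have h1 := h.div_const c
    rw [div_self hc0] at h1
    refine h1.congr fun x => ?_
    rw [div_div]
    congr 1
    rw [hc]
    ring
  rcases Nat.even_or_odd' M with ⟨N, rfl | hM⟩
  · have hco : Nat.Coprime 2 N := Nat.coprime_of_squarefree_mul hMsf
    have hN : Odd N := Nat.coprime_two_left.1 hco
    have hsf : Squarefree N := hMsf.of_mul_right
    simp only [natCard_negFundDisc_coprime_two_mul]
    convert tendsto_natCount_squarefree_mod_four_coprime hN hsf (Or.inr rfl) using 2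
    rw [hc, hco.primeFactors_mul, Finset.prod_union hco.disjoint_primeFactors,
      Nat.Prime.primeFactors Nat.prime_two, Finset.prod_singleton]
    push_cast
    rw [mul_div_mul_comm]
    ring
  · have hodd : Odd M := ⟨N, hM⟩
    simp only [natCard_negFundDisc_coprime_of_odd hodd]
    have h1 := tendsto_natCount_squarefree_mod_four_coprime hodd hMsf (Or.inl rfl)
    have h3 := tendsto_natCount_squarefree_mod_four_coprime hodd hMsf (Or.inr rfl)
    have h4 : Tendsto (fun x : ℝ => x / 4) atTop atTop :=
      tendsto_id.atTop_div_const (by norm_num)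
    have h8 : Tendsto (fun x : ℝ => x / 8) atTop atTop :=
      tendsto_id.atTop_div_const (by norm_num)
    have h := (h3.add ((h1.comp h4).div_const 4)).add
      (((h1.comp h8).div_const 8).add ((h3.comp h8).div_const 8))
    convert h using 2 with x
    · simp only [Function.comp]
      push_cast
      rw [add_div, add_div, add_div, div_div, div_div, div_div,
        div_mul_cancel₀ x (by norm_num : (4 : ℝ) ≠ 0),
        div_mul_cancel₀ x (by norm_num : (8 : ℝ) ≠ 0)]
    · rw [hc]
      ring
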